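/- Let Φ be a nonempty finite set of nonzero vectors in ℝ^N, let H(Φ) be the graph shift-invariant space generated by Φ, let F_N be the matrix whose columns are the vectors S^α φ for α ∈ Σ_{N−1} and φ ∈ Φ, and let Ω = ∪_{φ ∈ Φ} supp φ̂. Then rank(F_N) = dim H(Φ) = #Ω. -/

import Mathlib

open Matrix

/-- `S^α = S 0 ^ α 0 * S 1 ^ α 1 * ⋯ * S (L-1) ^ α (L-1)`. -/
def Spow {N L : ℕ} (S : Fin L → Matrix (Fin N) (Fin N) ℝ) (α : Fin L → ℕ) :
    Matrix (Fin N) (Fin N) ℝ :=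
  (List.ofFn fun l => S l ^ α l).prod

/-- The index set `Σ_{N−1} = {α ∈ ℤ₊^L : α₁ + ⋯ + α_L ≤ N − 1}` (each component is then
necessarily `< N`). -/
def SigmaIdx (L N : ℕ) : Type :=
  {α : Fin L → Fin N // (∑ l, (α l : ℕ)) ≤ N - 1}

instance (L N : ℕ) : Fintype (SigmaIdx L N) := by
  unfold SigmaIdx; infer_instance

/-- Joint functional calculus on monomials: `S^α` acts on the Fourier side as multiplication by the
monomial `λ(n)^α`. -/
theorem Spow_eq_conj_diagonal {N L : ℕ} (S : Fin L → Matrix (Fin N) (Fin N) ℝ)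
    (U : Matrix (Fin N) (Fin N) ℝ) (lam : Fin L → Fin N → ℝ)
    (hU : Uᵀ * U = 1 ∧ U * Uᵀ = 1)
    (hdiag : ∀ l, S l = U * Matrix.diagonal (lam l) * Uᵀ) (α : Fin L → ℕ) :
    Spow S α = U * Matrix.diagonal (fun n => ∏ l, lam l n ^ α l) * Uᵀ := by
  have hpow : ∀ l k, S l ^ k = U * Matrix.diagonal (fun n => lam l n ^ k) * Uᵀ := by
    intro l k
    induction k with
    | zero => simp [hU.2]
    | succ k ih =>
      calc S l ^ (k + 1)
          = U * Matrix.diagonal (fun n => lam l n ^ k) * (Uᵀ * U) *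
              Matrix.diagonal (lam l) * Uᵀ := by
            rw [pow_succ, ih, hdiag l]; simp only [Matrix.mul_assoc]
        _ = _ := by
            rw [hU.1, Matrix.mul_one, Matrix.mul_assoc U, Matrix.diagonal_mul_diagonal]
            simp only [pow_succ]
  unfold Spow
  simp only [hpow]
  clear hpow hdiag S
  induction L with
  | zero => simp [hU.2]
  | succ L ih =>
    rw [List.ofFn_succ, List.prod_cons, ih (fun l => lam l.succ) (fun l => α l.succ)]
    calc _ = U * Matrix.diagonal (fun n => lam 0 n ^ α 0) * (Uᵀ * U) *
              Matrix.diagonal (fun n => ∏ l : Fin L, lam l.succ n ^ α l.succ) * Uᵀ := by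
            simp only [Matrix.mul_assoc]
      _ = _ := by
            rw [hU.1, Matrix.mul_one, Matrix.mul_assoc U, Matrix.diagonal_mul_diagonal]
            simp only [Fin.prod_univ_succ]

/-- `S^α x` as the inverse Fourier transform of `λ(·)^α x̂`. -/
theorem Spow_mulVec {N L : ℕ} (S : Fin L → Matrix (Fin N) (Fin N) ℝ)
    (U : Matrix (Fin N) (Fin N) ℝ) (lam : Fin L → Fin N → ℝ)
    (hU : Uᵀ * U = 1 ∧ U * Uᵀ = 1)
    (hdiag : ∀ l, S l = U * Matrix.diagonal (lam l) * Uᵀ) (α : Fin L → ℕ) (x : Fin N → ℝ) :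
    Spow S α *ᵥ x = ∑ n, ((∏ l, lam l n ^ α l) * (Uᵀ *ᵥ x) n) • U.col n := by
  rw [Spow_eq_conj_diagonal S U lam hU hdiag, ← Matrix.mulVec_mulVec, ← Matrix.mulVec_mulVec]
  ext i
  rw [Matrix.mulVec, dotProduct]
  simp only [Matrix.mulVec_diagonal, Finset.sum_apply, Pi.smul_apply, Matrix.col_apply, smul_eq_mul]
  exact Finset.sum_congr rfl fun n _ => mul_comm _ _

/-- Multivariate Lagrange interpolation: a polynomial of total degree at most `N - 1` that
vanishes at all of `N` distinct points except a prescribed one. -/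
theorem exists_totalDegree_le_eval_ne_zero {K : Type*} [Field K] {N L : ℕ}
    (lam : Fin L → Fin N → K) (hspec : ∀ n m : Fin N, (∀ l, lam l n = lam l m) → n = m)
    (n : Fin N) :
    ∃ P : MvPolynomial (Fin L) K, P.totalDegree ≤ N - 1 ∧
      MvPolynomial.eval (fun l => lam l n) P ≠ 0 ∧
      ∀ m, m ≠ n → MvPolynomial.eval (fun l => lam l m) P = 0 := by
  have hsep : ∀ m : Fin N, ∃ Q : MvPolynomial (Fin L) K, Q.totalDegree ≤ 1 ∧
      (m ≠ n → MvPolynomial.eval (fun l => lam l n) Q ≠ 0 ∧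
        MvPolynomial.eval (fun l => lam l m) Q = 0) := by
    intro m
    by_cases hmn : m = n
    · exact ⟨0, by simp, fun h => absurd hmn h⟩
    · obtain ⟨l, hl⟩ : ∃ l, lam l n ≠ lam l m := by
        by_contra! h
        exact hmn (hspec n m h).symm
      refine ⟨MvPolynomial.X l - MvPolynomial.C (lam l m), ?_, fun _ => ⟨?_, by simp⟩⟩
      · exact (MvPolynomial.totalDegree_sub_C_le _ _).trans (by simp)
      · simpa [sub_eq_zero] using hl
  choose Q hdeg hQ using hsep
  refine ⟨∏ m ∈ Finset.univ.erase n, Q m, ?_, ?_, ?_⟩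
  · calc _ ≤ ∑ m ∈ Finset.univ.erase n, (Q m).totalDegree :=
          MvPolynomial.totalDegree_finsetProd _ _
      _ ≤ ∑ _m ∈ Finset.univ.erase n, 1 := Finset.sum_le_sum fun m _ => hdeg m
      _ = N - 1 := by simp
  · rw [map_prod]
    exact Finset.prod_ne_zero_iff.mpr fun m hm => (hQ m (Finset.ne_of_mem_erase hm)).1
  · intro m hm
    rw [map_prod]
    exact Finset.prod_eq_zero (Finset.mem_erase.mpr ⟨hm, Finset.mem_univ m⟩) (hQ m hm).2

/-- Every Fourier mode in the spectral support of `x` is a combination of the shifts `S^α x`,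
`α ∈ Σ_{N-1}`. -/
theorem col_mem_span_Spow_mulVec {N L : ℕ} (S : Fin L → Matrix (Fin N) (Fin N) ℝ)
    (U : Matrix (Fin N) (Fin N) ℝ) (lam : Fin L → Fin N → ℝ)
    (hU : Uᵀ * U = 1 ∧ U * Uᵀ = 1)
    (hdiag : ∀ l, S l = U * Matrix.diagonal (lam l) * Uᵀ)
    (hspec : ∀ n m : Fin N, (∀ l, lam l n = lam l m) → n = m)
    (x : Fin N → ℝ) (n : Fin N) (hn : (Uᵀ *ᵥ x) n ≠ 0) :
    U.col n ∈ Submodule.span ℝ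
      (Set.range fun α : SigmaIdx L N => Spow S (fun l => (α.1 l : ℕ)) *ᵥ x) := by
  obtain ⟨P, hdeg, hPn, hPm⟩ := exists_totalDegree_le_eval_ne_zero lam hspec n
  have hsum : ∑ d ∈ P.support, P.coeff d • (Spow S d *ᵥ x) =
      (MvPolynomial.eval (fun l => lam l n) P * (Uᵀ *ᵥ x) n) • U.col n := by
    calc _ = ∑ m, (MvPolynomial.eval (fun l => lam l m) P * (Uᵀ *ᵥ x) m) • U.col m := by
          simp only [Spow_mulVec S U lam hU hdiag, MvPolynomial.eval_eq', Finset.smul_sum,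
            Finset.sum_mul, Finset.sum_smul, smul_smul, mul_assoc]
          exact Finset.sum_comm
      _ = _ := Finset.sum_eq_single n (fun m _ hm => by rw [hPm m hm, zero_mul, zero_smul])
          (fun h => absurd (Finset.mem_univ n) h)
  rw [← Submodule.smul_mem_iff _ (mul_ne_zero hPn hn), ← hsum]
  refine Submodule.sum_mem _ fun d hd => Submodule.smul_mem _ _ (Submodule.subset_span ?_)
  have hd_sum : ∑ l, d l ≤ N - 1 := by
    have := (MvPolynomial.le_totalDegree hd).trans hdeg
    rwa [Finsupp.sum_fintype _ _ fun _ => rfl] at this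
  have hd_lt : ∀ l, d l < N := fun l => by
    have := Finset.single_le_sum (fun i _ => Nat.zero_le (d i)) (Finset.mem_univ l)
    have := n.pos
    omega
  exact ⟨⟨fun l => ⟨d l, hd_lt l⟩, hd_sum⟩, rfl⟩

/-- The rank of the frame matrix `F_N = [S^α φ_r]_{α ∈ Σ_{N−1}, r}` equals the
dimension of the graph shift-invariant space `H(Φ)`, which equals the cardinality of
`Ω = ⋃_{φ ∈ Φ} supp φ̂`. -/
theorem stmt17 {N L : ℕ} (hN : 1 ≤ N) (hL : 1 ≤ L)
    (S : Fin L → Matrix (Fin N) (Fin N) ℝ)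
    (U : Matrix (Fin N) (Fin N) ℝ)
    (lam : Fin L → Fin N → ℝ)
    (hsymm : ∀ l, (S l)ᵀ = S l)
    (hcomm : ∀ l l', S l * S l' = S l' * S l)
    (hU : Uᵀ * U = 1 ∧ U * Uᵀ = 1)
    (hdiag : ∀ l, S l = U * Matrix.diagonal (lam l) * Uᵀ)
    (hspec : ∀ n m : Fin N, (∀ l, lam l n = lam l m) → n = m)
    (R : ℕ) (hR : 1 ≤ R) (φ : Fin R → Fin N → ℝ) (hφ : ∀ r, φ r ≠ 0)
    (FN : Matrix (Fin N) (SigmaIdx L N × Fin R) ℝ)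
    (hFN : ∀ i p, FN i p = (Spow S (fun l => (p.1.1 l : ℕ)) *ᵥ φ p.2) i) :
    FN.rank =
      Module.finrank ℝ (Submodule.span ℝ
        {v | ∃ (α : Fin L → ℕ) (r : Fin R), v = Spow S α *ᵥ φ r}) ∧
    Module.finrank ℝ (Submodule.span ℝ
        {v | ∃ (α : Fin L → ℕ) (r : Fin R), v = Spow S α *ᵥ φ r}) =
      {n : Fin N | ∃ r, (Uᵀ *ᵥ φ r) n ≠ 0}.ncard := by
  set H := Submodule.span ℝ {v | ∃ (α : Fin L → ℕ) (r : Fin R), v = Spow S α *ᵥ φ r} with hH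
  set Ω : Set (Fin N) := {n | ∃ r, (Uᵀ *ᵥ φ r) n ≠ 0}
  have hcol : ∀ p : SigmaIdx L N × Fin R, FN.col p = Spow S (fun l => (p.1.1 l : ℕ)) *ᵥ φ p.2 :=
    fun p => funext fun i => hFN i p
  have hFH : Submodule.span ℝ (Set.range FN.col) ≤ H := by
    rw [Submodule.span_le]
    rintro _ ⟨p, rfl⟩
    exact Submodule.subset_span ⟨_, p.2, hcol p⟩
  have hHW : H ≤ Submodule.span ℝ (Set.range fun n : Ω => U.col n) := by
    rw [hH, Submodule.span_le]
    rintro _ ⟨α, r, rfl⟩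
    rw [SetLike.mem_coe, Spow_mulVec S U lam hU hdiag]
    refine Submodule.sum_mem _ fun n _ => ?_
    by_cases hn : (Uᵀ *ᵥ φ r) n = 0
    · rw [hn, mul_zero, zero_smul]
      exact Submodule.zero_mem _
    · exact Submodule.smul_mem _ _ (Submodule.subset_span ⟨⟨n, r, hn⟩, rfl⟩)
  have hWF : Submodule.span ℝ (Set.range fun n : Ω => U.col n) ≤
      Submodule.span ℝ (Set.range FN.col) := by
    rw [Submodule.span_le]
    rintro _ ⟨⟨n, r, hn⟩, rfl⟩
    refine Submodule.span_mono ?_ (col_mem_span_Spow_mulVec S U lam hU hdiag hspec (φ r) n hn)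
    rintro _ ⟨α, rfl⟩
    exact ⟨(α, r), hcol (α, r)⟩
  have hli : LinearIndependent ℝ (fun n : Ω => U.col n) :=
    (Matrix.linearIndependent_cols_of_isUnit (IsUnit.of_mul_eq_one _ hU.2)).comp _
      Subtype.val_injective
  refine ⟨?_, ?_⟩
  · rw [Matrix.rank_eq_finrank_span_cols, le_antisymm hFH (hHW.trans hWF)]
  · classical
    rw [le_antisymm hHW (hWF.trans hFH), finrank_span_eq_card hli, ← Nat.card_eq_fintype_card,
      Nat.card_coe_set_eq]
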